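/- Let 𝓕 be a Kalton space on U with values in Σ, let z ∈ U, let c ≥ 1 and let B_z be a homogeneous bounded selection for δ_z with constant c, with associated derivation Ω_z = δ'_z ∘ B_z. Consider the derived space dX_z = {(f'(z), f(z)) : f ∈ 𝓕} ⊆ Σ × Σ with the quotient norm ‖(a,b)‖ = inf{‖f‖_𝓕 : f ∈ 𝓕, f'(z) = a, f(z) = b}, and its closed subspace j_z(X_z) = {(x,0) : x ∈ X_z}. Then there exists a bounded linear projection from dX_z onto j_z(X_z) if and only if there exists a linear map L : X_z → Σ such that (Ω_z − L)(x) ∈ X_z for every x ∈ X_z and Ω_z − L is a bounded map from X_z to X_z, i.e. sup{‖Ω_z x − Lx‖_z : ‖x‖_z ≤ 1} < ∞. -/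

import Mathlib

open Complex Metric Set

noncomputable section

/-- A conformal equivalence (analytic bijection) of `U` onto `V`. -/
def ConformalEquivOn (φ : ℂ → ℂ) (U V : Set ℂ) : Prop :=
  DifferentiableOn ℂ φ U ∧ Set.BijOn φ U V

/-- A Kalton space of analytic functions on an open set `U ⊆ ℂ` conformally equivalent to the
open unit disc, with values in the complex Banach space `Sig`.  The Banach carrier is `F`, whose
elements are identified with analytic functions `ℂ → Sig` (only the restriction to `U` matters)
via the injective linear map `toFun`. -/
structure KaltonSpace (U : Set ℂ) (Sig : Type*) (F : Type*)
    [NormedAddCommGroup Sig] [NormedSpace ℂ Sig] [CompleteSpace Sig]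
    [NormedAddCommGroup F] [NormedSpace ℂ F] [CompleteSpace F] where
  isOpen : IsOpen U
  conformal_exists : ∃ φ : ℂ → ℂ, ConformalEquivOn φ U (Metric.ball (0 : ℂ) 1)
  toFun : F →ₗ[ℂ] (ℂ → Sig)
  inj : ∀ f g : F, Set.EqOn (toFun f) (toFun g) U → f = g
  analytic : ∀ f : F, DifferentiableOn ℂ (toFun f) U
  eval_bound : ∀ z ∈ U, ∃ C : ℝ, ∀ f : F, ‖toFun f z‖ ≤ C * ‖f‖
  conf_mul_mem : ∀ φ : ℂ → ℂ, ConformalEquivOn φ U (Metric.ball (0 : ℂ) 1) →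
    ∀ f : F, ∃ g : F, (∀ z ∈ U, toFun g z = φ z • toFun f z) ∧ ‖g‖ = ‖f‖
  conf_div_mem : ∀ φ : ℂ → ℂ, ConformalEquivOn φ U (Metric.ball (0 : ℂ) 1) →
    ∀ h : ℂ → Sig, DifferentiableOn ℂ h U →
    ∀ g : F, (∀ z ∈ U, toFun g z = φ z • h z) →
    ∃ f : F, (∀ z ∈ U, toFun f z = h z) ∧ ‖f‖ = ‖g‖

namespace KaltonSpace

variable {U : Set ℂ} {Sig F : Type*}
  [NormedAddCommGroup Sig] [NormedSpace ℂ Sig] [CompleteSpace Sig]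
  [NormedAddCommGroup F] [NormedSpace ℂ F] [CompleteSpace F]

/-- `x` belongs to the interpolation space `X_z = {f z : f ∈ 𝓕}`. -/
def MemX (K : KaltonSpace U Sig F) (z : ℂ) (x : Sig) : Prop :=
  ∃ f : F, K.toFun f z = x

/-- The quotient norm `‖x‖_z = inf {‖f‖ : f ∈ 𝓕, f z = x}` of `X_z`. -/
def normX (K : KaltonSpace U Sig F) (z : ℂ) (x : Sig) : ℝ :=
  sInf {r : ℝ | ∃ f : F, K.toFun f z = x ∧ r = ‖f‖}

/-- `B` is a homogeneous bounded selection for the evaluation `δ_z`, with constant `c`. -/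
def IsSelection (K : KaltonSpace U Sig F) (z : ℂ) (c : ℝ) (B : Sig → F) : Prop :=
  (∀ (l : ℂ) (x : Sig), K.MemX z x → B (l • x) = l • B x) ∧
  (∀ x : Sig, K.MemX z x → K.toFun (B x) z = x) ∧
  (∀ x : Sig, K.MemX z x → ‖B x‖ ≤ c * K.normX z x)

end KaltonSpace

section Statement9

variable {U : Set ℂ} {Sig F : Type*}
  [NormedAddCommGroup Sig] [NormedSpace ℂ Sig] [CompleteSpace Sig]
  [NormedAddCommGroup F] [NormedSpace ℂ F] [CompleteSpace F]

/-- The derived space `dX_z = {(f'(z), f(z)) : f ∈ 𝓕} ⊆ Σ × Σ`, as a subset. -/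
def kaltonDerivedSet (K : KaltonSpace U Sig F) (z : ℂ) : Set (Sig × Sig) :=
  {p | ∃ f : F, deriv (K.toFun f) z = p.1 ∧ K.toFun f z = p.2}

/-- The quotient norm `‖(a,b)‖ = inf {‖f‖_𝓕 : f'(z) = a, f(z) = b}` on `dX_z`. -/
def kaltonDerivedNorm (K : KaltonSpace U Sig F) (z : ℂ) (p : Sig × Sig) : ℝ :=
  sInf {r : ℝ | ∃ f : F, deriv (K.toFun f) z = p.1 ∧ K.toFun f z = p.2 ∧ r = ‖f‖}

/-- The copy `j_z(X_z) = {(x, 0) : x ∈ X_z}` of `X_z` inside `dX_z`. -/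
def kaltonDerivedCopy (K : KaltonSpace U Sig F) (z : ℂ) : Set (Sig × Sig) :=
  {p | K.MemX z p.1 ∧ p.2 = 0}

/-- An injective holomorphic function has nonvanishing derivative. -/
theorem deriv_ne_zero_of_injOn_nhds {φ : ℂ → ℂ} {z : ℂ} {V : Set ℂ} (hV : V ∈ nhds z)
    (hφ : AnalyticAt ℂ φ z) (hinj : Set.InjOn φ V) : deriv φ z ≠ 0 := by
  intro hd
  have hf : AnalyticAt ℂ (fun w => φ w - φ z) z := hφ.sub analyticAt_const
  have hnz : ¬ ∀ᶠ w in nhds z, φ w - φ z = 0 := by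
    intro h
    obtain ⟨w, ⟨hw, hwV⟩, hne⟩ :=
      (((h.and hV).filter_mono nhdsWithin_le_nhds).and
        (self_mem_nhdsWithin (a := z) (s := {z}ᶜ))).exists
    exact hne (hinj hwV (mem_of_mem_nhds hV) (sub_eq_zero.1 hw))
  obtain ⟨n, g, hg, hgz, hfg⟩ := hf.exists_eventuallyEq_pow_smul_nonzero_iff.2 hnz
  have hn0 : n ≠ 0 := by
    rintro rfl
    have := hfg.self_of_nhds
    simp at this
    exact hgz this.symm
  have hn1 : n ≠ 1 := by
    rintro rfl
    have h1 : HasDerivAt (fun w => (w - z) ^ 1 • g w) (g z) z := by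
      have := ((hasDerivAt_id z).sub_const z).mul hg.differentiableAt.hasDerivAt
      simpa [Pi.mul_def] using this
    have h2 := (h1.congr_of_eventuallyEq hfg).deriv
    rw [deriv_sub_const, hd] at h2
    exact hgz h2.symm
  -- a local root `k` of `φ - φ z`, up to a constant factor
  let h : ℂ → ℂ := fun w => Complex.exp (Complex.log (g w / g z) / n)
  let k : ℂ → ℂ := fun w => (w - z) * h w
  have hh : AnalyticAt ℂ h z := by
    refine AnalyticAt.cexp (AnalyticAt.div (AnalyticAt.clog (hg.div analyticAt_const hgz) ?_)
      analyticAt_const (by exact_mod_cast hn0))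
    simp [hgz]
  have hhz : h z = 1 := by simp [h, hgz]
  have hk : AnalyticAt ℂ k z := (analyticAt_id.sub analyticAt_const).mul hh
  have hkd : HasDerivAt k 1 z := by
    have := ((hasDerivAt_id z).sub_const z).mul hh.differentiableAt.hasDerivAt
    exact this.congr_deriv (by simp [hhz])
  have hks : HasStrictDerivAt k 1 z := by
    have := hk.hasStrictDerivAt
    rwa [hkd.deriv] at this
  have hmap : Filter.map k (nhds z) = nhds 0 := by
    have := hks.map_nhds_eq one_ne_zero
    simpa [k] using this
  have hkf : ∀ᶠ w in nhds z, φ w - φ z = k w ^ n * g z := by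
    filter_upwards [hfg, hg.continuousAt.eventually_ne hgz] with w hw hw0
    have hpow : h w ^ n = g w / g z := by
      simp only [h]
      rw [← Complex.exp_nat_mul, mul_div_cancel₀ _ (by exact_mod_cast hn0),
        Complex.exp_log (div_ne_zero hw0 hgz)]
    rw [hw, smul_eq_mul, mul_pow, hpow]
    field_simp
  have hS : k '' {w | φ w - φ z = k w ^ n * g z ∧ w ∈ V} ∈ nhds (0 : ℂ) := by
    rw [← hmap]
    exact Filter.image_mem_map (hkf.and hV)
  have hζ := Complex.isPrimitiveRoot_exp n hn0
  set ζ := Complex.exp (2 * Real.pi * Complex.I / n)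
  have hcont : Filter.Tendsto (fun a : ℂ => ζ * a) (nhds 0) (nhds 0) := by
    have : Continuous fun a : ℂ => ζ * a := by fun_prop
    simpa using this.tendsto 0
  obtain ⟨a, ⟨⟨w₁, ⟨h1, h1V⟩, rfl⟩, w₂, ⟨h2, h2V⟩, h21⟩, ha⟩ :=
    (((Filter.Eventually.and hS (hcont.eventually hS)).filter_mono nhdsWithin_le_nhds).and
      (self_mem_nhdsWithin (a := (0 : ℂ)) (s := {0}ᶜ))).exists
  have hw : w₁ = w₂ := by
    apply hinj h1V h2V
    rw [h21, mul_pow, hζ.pow_eq_one, one_mul, ← h1] at h2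
    exact (sub_left_inj.1 h2).symm
  subst hw
  have hζ1 : ζ = 1 := mul_right_cancel₀ ha (by rw [← h21, one_mul])
  exact hn1 (hζ.unique (hζ1 ▸ IsPrimitiveRoot.one))

theorem one_sub_conj_mul_ne_zero {a w : ℂ} (ha : ‖a‖ < 1) (hw : ‖w‖ < 1) :
    1 - starRingEnd ℂ a * w ≠ 0 := by
  intro h
  have h1 : ‖starRingEnd ℂ a * w‖ = 1 := by rw [← sub_eq_zero.1 h, norm_one]
  rw [norm_mul, RCLike.norm_conj] at h1
  nlinarith [norm_nonneg a, norm_nonneg w]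

theorem norm_moebius_lt_one {a w : ℂ} (ha : ‖a‖ < 1) (hw : ‖w‖ < 1) :
    ‖(w - a) / (1 - starRingEnd ℂ a * w)‖ < 1 := by
  rw [norm_div, div_lt_one (norm_pos_iff.2 (one_sub_conj_mul_ne_zero ha hw))]
  refine lt_of_pow_lt_pow_left₀ 2 (norm_nonneg _) ?_
  have ha' : ‖a‖ ^ 2 < 1 := by nlinarith [norm_nonneg a]
  have hw' : ‖w‖ ^ 2 < 1 := by nlinarith [norm_nonneg w]
  rw [Complex.sq_norm, Complex.normSq_apply] at *
  rw [Complex.sq_norm, Complex.normSq_apply] at *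
  simp
  nlinarith [mul_pos (sub_pos.2 ha') (sub_pos.2 hw')]

theorem moebius_leftInverse {a w : ℂ} (ha : ‖a‖ < 1) (hw : ‖w‖ < 1) :
    ((w - a) / (1 - starRingEnd ℂ a * w) - -a) /
      (1 - starRingEnd ℂ (-a) * ((w - a) / (1 - starRingEnd ℂ a * w))) = w := by
  have h1 := one_sub_conj_mul_ne_zero ha hw
  have h3 := one_sub_conj_mul_ne_zero (a := -a) (by simpa using ha) (norm_moebius_lt_one ha hw)
  rw [div_eq_iff h3, map_neg]
  generalize starRingEnd ℂ a = b at h1 ⊢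
  have h1' : 1 - w * b ≠ 0 := by rwa [mul_comm w b]
  field_simp
  ring

/-- The Möbius map `w ↦ (w - a) / (1 - conj a * w)` is an automorphism of the unit disc. -/
theorem conformalEquivOn_moebius {a : ℂ} (ha : ‖a‖ < 1) :
    ConformalEquivOn (fun w => (w - a) / (1 - starRingEnd ℂ a * w)) (ball 0 1) (ball 0 1) := by
  have hna : ‖-a‖ < 1 := by simpa using ha
  refine ⟨?_, Set.InvOn.bijOn (f' := fun w => (w - -a) / (1 - starRingEnd ℂ (-a) * w))
    ⟨fun w hw => ?_, fun w hw => ?_⟩ (fun w hw => ?_) (fun w hw => ?_)⟩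
  · intro w hw
    have := one_sub_conj_mul_ne_zero ha (mem_ball_zero_iff.1 hw)
    exact DifferentiableAt.differentiableWithinAt (by fun_prop (disch := assumption))
  · exact moebius_leftInverse ha (mem_ball_zero_iff.1 hw)
  · simpa using moebius_leftInverse hna (mem_ball_zero_iff.1 hw)
  · exact mem_ball_zero_iff.2 (norm_moebius_lt_one ha (mem_ball_zero_iff.1 hw))
  · exact mem_ball_zero_iff.2 (norm_moebius_lt_one hna (mem_ball_zero_iff.1 hw))

namespace KaltonSpace

theorem exists_conformalEquivOn_eq_zero (K : KaltonSpace U Sig F) {z : ℂ} (hz : z ∈ U) :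
    ∃ φ : ℂ → ℂ, ConformalEquivOn φ U (ball 0 1) ∧ φ z = 0 := by
  obtain ⟨φ, hφd, hφ⟩ := K.conformal_exists
  have ha : ‖φ z‖ < 1 := mem_ball_zero_iff.1 (hφ.mapsTo hz)
  obtain ⟨hmd, hm⟩ := conformalEquivOn_moebius ha
  exact ⟨_, ⟨hmd.comp hφd hφ.mapsTo, hm.comp hφ⟩, by simp⟩

theorem differentiableAt (K : KaltonSpace U Sig F) {z : ℂ} (hz : z ∈ U) (f : F) :
    DifferentiableAt ℂ (K.toFun f) z :=
  (K.analytic f).differentiableAt (K.isOpen.mem_nhds hz)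

/-- Evaluation of the derivative at a point of the domain, as a linear map. -/
def derivLM (K : KaltonSpace U Sig F) {z : ℂ} (hz : z ∈ U) : F →ₗ[ℂ] Sig where
  toFun f := deriv (K.toFun f) z
  map_add' f g := by
    rw [map_add]
    exact deriv_add (K.differentiableAt hz f) (K.differentiableAt hz g)
  map_smul' l f := by
    rw [map_smul]
    exact deriv_const_smul l (K.differentiableAt hz f)

/-- Up to a nonzero factor, derivatives at `z` of functions vanishing at `z` are the values at `z`
of functions of the same norm. -/
theorem exists_deriv_eq_smul (K : KaltonSpace U Sig F) {z : ℂ} (hz : z ∈ U) :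
    ∃ d : ℂ, d ≠ 0 ∧
      (∀ f : F, K.toFun f z = 0 → ∃ g : F, ‖g‖ = ‖f‖ ∧ deriv (K.toFun f) z = d • K.toFun g z) ∧
      (∀ g : F, ∃ f : F, ‖f‖ = ‖g‖ ∧ K.toFun f z = 0 ∧
        deriv (K.toFun f) z = d • K.toFun g z) := by
  obtain ⟨φ, hφ, hφz⟩ := K.exists_conformalEquivOn_eq_zero hz
  have hU : U ∈ nhds z := K.isOpen.mem_nhds hz
  have hφd : DifferentiableAt ℂ φ z := hφ.1.differentiableAt hU
  have hd : deriv φ z ≠ 0 :=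
    deriv_ne_zero_of_injOn_nhds hU (hφ.1.analyticAt hU) hφ.2.injOn
  have key : ∀ f g : F, (∀ w ∈ U, K.toFun f w = φ w • K.toFun g w) →
      deriv (K.toFun f) z = deriv φ z • K.toFun g z := by
    intro f g h
    have h1 : K.toFun f =ᶠ[nhds z] fun w => φ w • K.toFun g w := Filter.mem_of_superset hU h
    rw [h1.deriv_eq, (hφd.hasDerivAt.fun_smul (K.differentiableAt hz g).hasDerivAt).deriv, hφz]
    simp
  refine ⟨deriv φ z, hd, fun f hf => ?_, fun g => ?_⟩
  · have hne : ∀ w ∈ U, dslope φ z w ≠ 0 := by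
      intro w hw
      rcases eq_or_ne w z with rfl | hwz
      · rwa [dslope_same]
      · intro h
        have := sub_smul_dslope φ z w
        rw [h, smul_zero] at this
        exact hwz (hφ.2.injOn hw hz (sub_eq_zero.1 this.symm))
    obtain ⟨g, hg, hgn⟩ := K.conf_div_mem φ hφ
      (fun w => (dslope φ z w)⁻¹ • dslope (K.toFun f) z w)
      ((((Complex.differentiableOn_dslope hU).2 hφ.1).inv hne).smul
        ((Complex.differentiableOn_dslope hU).2 (K.analytic f))) f (by
        intro w hw
        have h1 := sub_smul_dslope φ z w
        have h2 := sub_smul_dslope (K.toFun f) z w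
        rw [hφz, sub_zero, smul_eq_mul] at h1
        rw [hf, sub_zero] at h2
        rw [← h1, smul_smul, mul_assoc, mul_inv_cancel₀ (hne w hw), mul_one, h2])
    refine ⟨g, hgn, key f g fun w hw => ?_⟩
    have h1 := sub_smul_dslope φ z w
    have h2 := sub_smul_dslope (K.toFun f) z w
    rw [hφz, sub_zero, smul_eq_mul] at h1
    rw [hf, sub_zero] at h2
    rw [hg w hw, ← h1, smul_smul, mul_assoc, mul_inv_cancel₀ (hne w hw), mul_one, h2]
  · obtain ⟨f, hf, hfn⟩ := K.conf_mul_mem φ hφ g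
    exact ⟨f, hfn, by rw [hf z hz, hφz, zero_smul], key f g hf⟩

variable {K : KaltonSpace U Sig F} {z : ℂ}

theorem MemX.add {x y : Sig} (hx : K.MemX z x) (hy : K.MemX z y) : K.MemX z (x + y) := by
  obtain ⟨f, rfl⟩ := hx
  obtain ⟨g, rfl⟩ := hy
  exact ⟨f + g, by simp⟩

theorem MemX.smul {x : Sig} (l : ℂ) (hx : K.MemX z x) : K.MemX z (l • x) := by
  obtain ⟨f, rfl⟩ := hx
  exact ⟨l • f, by simp⟩

theorem normX_le {x : Sig} {f : F} (hf : K.toFun f z = x) : K.normX z x ≤ ‖f‖ :=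
  csInf_le ⟨0, by rintro _ ⟨g, -, rfl⟩; exact norm_nonneg g⟩ ⟨f, hf, rfl⟩

theorem normX_nonneg (x : Sig) : 0 ≤ K.normX z x :=
  Real.sInf_nonneg (by rintro _ ⟨g, -, rfl⟩; exact norm_nonneg g)

theorem exists_norm_lt_normX_add {x : Sig} (hx : K.MemX z x) {ε : ℝ} (hε : 0 < ε) :
    ∃ f : F, K.toFun f z = x ∧ ‖f‖ < K.normX z x + ε := by
  obtain ⟨f, hf⟩ := hx
  obtain ⟨_, ⟨g, hg, rfl⟩, hlt⟩ := Real.lt_sInf_add_pos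
    (s := {r : ℝ | ∃ f : F, K.toFun f z = x ∧ r = ‖f‖}) ⟨_, f, hf, rfl⟩ hε
  exact ⟨g, hg, hlt⟩

theorem normX_add_le {x y : Sig} (hx : K.MemX z x) (hy : K.MemX z y) :
    K.normX z (x + y) ≤ K.normX z x + K.normX z y := by
  refine le_of_forall_pos_le_add fun ε hε => ?_
  obtain ⟨f, hf, hfn⟩ := exists_norm_lt_normX_add hx (half_pos hε)
  obtain ⟨g, hg, hgn⟩ := exists_norm_lt_normX_add hy (half_pos hε)
  have h : K.normX z (x + y) ≤ ‖f + g‖ := normX_le (by simp [hf, hg])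
  linarith [norm_add_le f g]

end KaltonSpace

theorem kaltonDerivedNorm_le {K : KaltonSpace U Sig F} {z : ℂ} {p : Sig × Sig} {f : F}
    (h1 : deriv (K.toFun f) z = p.1) (h2 : K.toFun f z = p.2) :
    kaltonDerivedNorm K z p ≤ ‖f‖ :=
  csInf_le ⟨0, by rintro _ ⟨g, -, -, rfl⟩; exact norm_nonneg g⟩ ⟨f, h1, h2, rfl⟩

theorem kaltonDerivedNorm_nonneg (K : KaltonSpace U Sig F) (z : ℂ) (p : Sig × Sig) :
    0 ≤ kaltonDerivedNorm K z p :=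
  Real.sInf_nonneg (by rintro _ ⟨g, -, -, rfl⟩; exact norm_nonneg g)

theorem le_mul_kaltonDerivedNorm {K : KaltonSpace U Sig F} {z : ℂ} {p : Sig × Sig}
    (hp : p ∈ kaltonDerivedSet K z) {A M : ℝ} (hM : 0 < M)
    (h : ∀ f : F, deriv (K.toFun f) z = p.1 → K.toFun f z = p.2 → A ≤ M * ‖f‖) :
    A ≤ M * kaltonDerivedNorm K z p := by
  rw [← div_le_iff₀' hM]
  obtain ⟨f, h1, h2⟩ := hp
  refine le_csInf ⟨_, f, h1, h2, rfl⟩ ?_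
  rintro _ ⟨g, h3, h4, rfl⟩
  exact (div_le_iff₀' hM).2 (h g h3 h4)

theorem kaltonDerivedSet_add {K : KaltonSpace U Sig F} {z : ℂ} (hz : z ∈ U) {p q : Sig × Sig}
    (hp : p ∈ kaltonDerivedSet K z) (hq : q ∈ kaltonDerivedSet K z) :
    p + q ∈ kaltonDerivedSet K z := by
  obtain ⟨f, h1, h2⟩ := hp
  obtain ⟨g, h3, h4⟩ := hq
  refine ⟨f + g, ?_, by simp [h2, h4]⟩
  rw [Prod.fst_add, ← h1, ← h3]
  exact (K.derivLM hz).map_add f g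

/-- There is a bounded linear projection of the derived space `dX_z` onto `j_z(X_z)` if and only
if there is a linear map `L : X_z → Σ` with `Ω_z − L` a bounded map from `X_z` to `X_z`. -/
theorem statement9
    (K : KaltonSpace U Sig F) (z : ℂ) (hz : z ∈ U)
    (c : ℝ) (hc : 1 ≤ c) (B : Sig → F) (hB : K.IsSelection z c B) :
    (∃ P : Sig × Sig → Sig × Sig,
      (∀ p q : Sig × Sig, p ∈ kaltonDerivedSet K z → q ∈ kaltonDerivedSet K z → P (p + q) = P p + P q) ∧
      (∀ (l : ℂ) (p : Sig × Sig), p ∈ kaltonDerivedSet K z → P (l • p) = l • P p) ∧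
      (∀ p : Sig × Sig, p ∈ kaltonDerivedSet K z → P p ∈ kaltonDerivedCopy K z) ∧
      (∀ p : Sig × Sig, p ∈ kaltonDerivedCopy K z → P p = p) ∧
      (∃ C : ℝ, ∀ p : Sig × Sig, p ∈ kaltonDerivedSet K z →
        kaltonDerivedNorm K z (P p) ≤ C * kaltonDerivedNorm K z p)) ↔
    (∃ L : Sig → Sig,
      (∀ x y : Sig, K.MemX z x → K.MemX z y → L (x + y) = L x + L y) ∧
      (∀ (l : ℂ) (x : Sig), K.MemX z x → L (l • x) = l • L x) ∧
      (∀ x : Sig, K.MemX z x → K.MemX z (deriv (K.toFun (B x)) z - L x)) ∧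
      (∃ C : ℝ, ∀ x : Sig, K.MemX z x →
        K.normX z (deriv (K.toFun (B x)) z - L x) ≤ C * K.normX z x)) := by
  obtain ⟨hBs, hBz, hBn⟩ := hB
  obtain ⟨d, hd, hA, hJ⟩ := K.exists_deriv_eq_smul hz
  have hdpos : 0 < ‖d‖ := norm_pos_iff.2 hd
  have hker : ∀ f : F, K.toFun f z = 0 → K.MemX z (deriv (K.toFun f) z) ∧
      K.normX z (deriv (K.toFun f) z) ≤ ‖d‖ * ‖f‖ := by
    intro f hf
    obtain ⟨g, hgn, hg⟩ := hA f hf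
    have h1 : K.toFun (d • g) z = deriv (K.toFun f) z := by simp [hg]
    refine ⟨⟨d • g, h1⟩, (KaltonSpace.normX_le h1).trans ?_⟩
    rw [norm_smul, hgn]
  have hcopy : ∀ g : F, ∃ f : F, ‖f‖ = ‖d‖⁻¹ * ‖g‖ ∧ K.toFun f z = 0 ∧
      deriv (K.toFun f) z = K.toFun g z := by
    intro g
    obtain ⟨f, hfn, hf0, hf⟩ := hJ (d⁻¹ • g)
    refine ⟨f, by rw [hfn, norm_smul, norm_inv], hf0, ?_⟩
    rw [hf, map_smul, Pi.smul_apply, smul_inv_smul₀ hd]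
  have hcopyset : ∀ p ∈ kaltonDerivedCopy K z, p ∈ kaltonDerivedSet K z := by
    rintro ⟨x, y⟩ ⟨⟨g, hg⟩, hy⟩
    obtain ⟨f, -, hf0, hf⟩ := hcopy g
    exact ⟨f, hf.trans hg, hf0.trans hy.symm⟩
  have hsub : ∀ f g : F, deriv (K.toFun (f - g)) z = deriv (K.toFun f) z - deriv (K.toFun g) z :=
    fun f g => (K.derivLM hz).map_sub f g
  have hadd : ∀ f g : F, deriv (K.toFun (f + g)) z = deriv (K.toFun f) z + deriv (K.toFun g) z :=
    fun f g => (K.derivLM hz).map_add f g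
  have hsmul : ∀ (l : ℂ) (f : F), deriv (K.toFun (l • f)) z = l • deriv (K.toFun f) z :=
    fun l f => (K.derivLM hz).map_smul l f
  have hΩ : ∀ x, K.MemX z x → (deriv (K.toFun (B x)) z, x) ∈ kaltonDerivedSet K z :=
    fun x hx => ⟨B x, rfl, hBz x hx⟩
  constructor
  · rintro ⟨P, hPadd, hPsmul, hPcopy, hPid, C, hPC⟩
    refine ⟨fun x => deriv (K.toFun (B x)) z - (P (deriv (K.toFun (B x)) z, x)).1,
      fun x y hx hy => ?_, fun l x hx => ?_, fun x hx => ?_, ‖d‖ * (|C| * c), fun x hx => ?_⟩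
    · have hxy := hx.add hy
      have h0 : K.toFun (B (x + y) - (B x + B y)) z = 0 := by
        simp [hBz _ hxy, hBz _ hx, hBz _ hy]
      have hw := (hker _ h0).1
      rw [hsub, hadd] at hw
      set w := deriv (K.toFun (B (x + y))) z -
        (deriv (K.toFun (B x)) z + deriv (K.toFun (B y)) z) with hwdef
      have hwc : (w, (0 : Sig)) ∈ kaltonDerivedCopy K z := ⟨hw, rfl⟩
      have hsum : (deriv (K.toFun (B (x + y))) z, x + y) =
          ((deriv (K.toFun (B x)) z, x) + (deriv (K.toFun (B y)) z, y)) + (w, (0 : Sig)) := by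
        simp [hwdef]
      have hP := hPadd _ _ (kaltonDerivedSet_add hz (hΩ x hx) (hΩ y hy)) (hcopyset _ hwc)
      rw [← hsum, hPadd _ _ (hΩ x hx) (hΩ y hy), hPid _ hwc] at hP
      simp only [hP, Prod.fst_add, hwdef]
      abel
    · have h1 : (deriv (K.toFun (B (l • x))) z, l • x) = l • (deriv (K.toFun (B x)) z, x) := by
        rw [hBs l x hx, hsmul, Prod.smul_mk]
      simp only [h1, hPsmul l _ (hΩ x hx), Prod.smul_fst]
      rw [hBs l x hx, hsmul, smul_sub]
    · simpa using (hPcopy _ (hΩ x hx)).1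
    · rw [sub_sub_cancel]
      have hc0 := hPcopy _ (hΩ x hx)
      have h1 : K.normX z (P (deriv (K.toFun (B x)) z, x)).1 ≤
          ‖d‖ * kaltonDerivedNorm K z (P (deriv (K.toFun (B x)) z, x)) := by
        refine le_mul_kaltonDerivedNorm (hcopyset _ hc0) hdpos fun f hf1 hf2 => ?_
        rw [← hf1]
        exact (hker f (hf2.trans hc0.2)).2
      have h2 : kaltonDerivedNorm K z (P (deriv (K.toFun (B x)) z, x)) ≤
          |C| * (c * K.normX z x) :=
        calc _ ≤ C * kaltonDerivedNorm K z (deriv (K.toFun (B x)) z, x) := hPC _ (hΩ x hx)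
          _ ≤ |C| * kaltonDerivedNorm K z (deriv (K.toFun (B x)) z, x) :=
            mul_le_mul_of_nonneg_right (le_abs_self C) (kaltonDerivedNorm_nonneg K z _)
          _ ≤ |C| * (c * K.normX z x) := by
            gcongr
            exact (kaltonDerivedNorm_le (f := B x) rfl (hBz x hx)).trans (hBn x hx)
      calc _ ≤ _ := h1
        _ ≤ ‖d‖ * (|C| * (c * K.normX z x)) := by gcongr
        _ = _ := by ring
  · rintro ⟨L, hLadd, hLsmul, hLmem, C, hLC⟩
    have hest : ∀ f : F, K.MemX z (deriv (K.toFun f) z - L (K.toFun f z)) ∧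
        K.normX z (deriv (K.toFun f) z - L (K.toFun f z)) ≤ (‖d‖ * (1 + c) + |C|) * ‖f‖ := by
      intro f
      have hx : K.MemX z (K.toFun f z) := ⟨f, rfl⟩
      have hxn : K.normX z (K.toFun f z) ≤ ‖f‖ := KaltonSpace.normX_le rfl
      obtain ⟨hm, hn⟩ := hker (f - B (K.toFun f z)) (by simp [hBz _ hx])
      rw [hsub] at hm hn
      have h1 := hLC _ hx
      have h2 : C * K.normX z (K.toFun f z) ≤ |C| * ‖f‖ :=
        mul_le_mul (le_abs_self C) hxn (KaltonSpace.normX_nonneg _) (abs_nonneg C)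
      have h3 : ‖f - B (K.toFun f z)‖ ≤ (1 + c) * ‖f‖ := by
        have h4 := (hBn _ hx).trans (mul_le_mul_of_nonneg_left hxn (zero_le_one.trans hc))
        linarith [norm_sub_le f (B (K.toFun f z))]
      have h5 := mul_le_mul_of_nonneg_left h3 hdpos.le
      have h6 := KaltonSpace.normX_add_le hm (hLmem _ hx)
      rw [← sub_add_sub_cancel _ (deriv (K.toFun (B (K.toFun f z))) z)]
      exact ⟨hm.add (hLmem _ hx), by linarith⟩
    have hL0 : L 0 = 0 := by simpa using hLsmul 0 0 ⟨0, by simp⟩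
    have hM : 0 < ‖d‖⁻¹ * (‖d‖ * (1 + c) + |C|) := by positivity
    refine ⟨fun p => (p.1 - L p.2, 0), ?_, ?_, ?_, ?_,
      ‖d‖⁻¹ * (‖d‖ * (1 + c) + |C|), fun p hp => ?_⟩
    · rintro p q ⟨f, -, hf⟩ ⟨g, -, hg⟩
      ext
      · simp only [Prod.fst_add, Prod.snd_add, hLadd _ _ ⟨f, hf⟩ ⟨g, hg⟩]
        abel
      · simp
    · rintro l p ⟨f, -, hf⟩
      ext
      · simp only [Prod.smul_fst, Prod.smul_snd, hLsmul l _ ⟨f, hf⟩, smul_sub]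
      · simp
    · rintro p ⟨f, hf1, hf2⟩
      refine ⟨?_, rfl⟩
      simp only [← hf1, ← hf2]
      exact (hest f).1
    · rintro ⟨x, y⟩ ⟨-, rfl⟩
      simp [hL0]
    · refine le_mul_kaltonDerivedNorm hp hM fun f hf1 hf2 => ?_
      obtain ⟨hm, hn⟩ := hest f
      rw [hf1, hf2] at hm hn
      refine le_of_forall_pos_le_add fun ε hε => ?_
      obtain ⟨g, hg, hgn⟩ := KaltonSpace.exists_norm_lt_normX_add hm (mul_pos hdpos hε)
      obtain ⟨k, hkn, hk0, hk⟩ := hcopy g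
      calc kaltonDerivedNorm K z (p.1 - L p.2, 0) ≤ ‖k‖ :=
            kaltonDerivedNorm_le (hk.trans hg) hk0
        _ = ‖d‖⁻¹ * ‖g‖ := hkn
        _ ≤ ‖d‖⁻¹ * ((‖d‖ * (1 + c) + |C|) * ‖f‖ + ‖d‖ * ε) := by
            gcongr
            linarith
        _ = _ := by field_simp

end Statement9
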